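/- Fix d = (d_1, …, d_m) with all d_i > 0 and ν ∈ (0, a). Let f : Q_{d,2} → ℝ and let u : ℝ^n → ℝ be a bounded classical solution of L u = f in Q_{d,2}. Define v, g : ℝ^{n+1} → ℝ by v(x, t) := u(x + t_+ e_n) - u(x - t_+ e_n) and g(x, t) := f(x + t_+ e_n) - f(x - t_+ e_n), where t_+ := max{t, 0}. Then for every (x, t) ∈ Q_d × (0, d_m), the quantity L_* v(x, t) is well defined (the relevant fractional integrals converge absolutely and the relevant second derivatives exist) and L_* v(x, t) = g(x, t). -/

import Mathlib

open MeasureTheory Real Filter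

noncomputable section

/-- The normalization constant `c_{N,s}`. -/
def cns (N : ℕ) (s : ℝ) : ℝ :=
  2 ^ (2 * s - 1) * Real.Gamma (s + (N : ℝ) / 2) /
    (Real.pi ^ ((N : ℝ) / 2) * |Real.Gamma (-s)|)

/-- The constant `η_i`. -/
def etaC (N : ℕ) (s : ℝ) : ℝ :=
  Real.Gamma ((N : ℝ) / 2) /
    (2 ^ (2 * s) * Real.Gamma (s + 1) * Real.Gamma (s + (N : ℝ) / 2))

/-- `ℝ^n` with coordinates grouped according to `N : ι → ℕ`. -/
abbrev GS {ι : Type*} (N : ι → ℕ) : Type _ :=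
  PiLp 2 (fun i : ι => EuclideanSpace ℝ (Fin (N i)))

/-- The inclusion `y ↦ y^{(i)}`. -/
def grpIncl {ι : Type*} [DecidableEq ι] (N : ι → ℕ) (i : ι)
    (y : EuclideanSpace ℝ (Fin (N i))) : GS N :=
  WithLp.toLp 2 (Pi.single i y)

/-- Second derivative of `u` at `x` in direction `v`. -/
def dirD2 {E : Type*} [NormedAddCommGroup E] [NormedSpace ℝ E]
    (u : E → ℝ) (x v : E) : ℝ :=
  iteratedDeriv 2 (fun t : ℝ => u (x + t • v)) 0

/-- The operator `(-Δ_{X_i})^{s_i}`. -/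
def gLap {ι : Type*} [Fintype ι] [DecidableEq ι] (N : ι → ℕ) (i : ι) (si : ℝ)
    (u : GS N → ℝ) (x : GS N) : ℝ :=
  if si = 1 then
    -∑ j : Fin (N i), dirD2 u x (grpIncl N i (EuclideanSpace.single j 1))
  else
    cns (N i) si *
      ∫ y : EuclideanSpace ℝ (Fin (N i)),
        (2 * u x - u (x + grpIncl N i y) - u (x - grpIncl N i y)) /
          ‖y‖ ^ ((N i : ℝ) + 2 * si)

/-- Absolute convergence of the integral defining `(-Δ_{X_i})^{s_i} u (x)`
(trivial in the local case `s_i = 1`). -/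
def gInt {ι : Type*} [Fintype ι] [DecidableEq ι] (N : ι → ℕ) (i : ι) (si : ℝ)
    (u : GS N → ℝ) (x : GS N) : Prop :=
  si = 1 ∨ Integrable (fun y : EuclideanSpace ℝ (Fin (N i)) =>
    (2 * u x - u (x + grpIncl N i y) - u (x - grpIncl N i y)) /
      ‖y‖ ^ ((N i : ℝ) + 2 * si))

/-- The operator `L = Σ_i a_i (-Δ_{X_i})^{s_i}`. -/
def Lop {ι : Type*} [Fintype ι] [DecidableEq ι] (N : ι → ℕ) (a s : ι → ℝ)
    (u : GS N → ℝ) (x : GS N) : ℝ :=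
  ∑ i, a i * gLap N i (s i) u x

/-- `u` is a classical solution of `L u = f` in `Ω`. -/
def IsSol {ι : Type*} [Fintype ι] [DecidableEq ι] (N : ι → ℕ) (a s : ι → ℝ)
    (u f : GS N → ℝ) (Ω : Set (GS N)) : Prop :=
  Continuous u ∧ ∀ x ∈ Ω, ContDiffAt ℝ 2 u x ∧ (∀ i, gInt N i (s i) u x) ∧
    Lop N a s u x = f x

/-- The unit vector `e_n` (the last group has one coordinate). -/
def eN {m : ℕ} (N : Fin (m + 1) → ℕ) : GS N :=
  grpIncl N (Fin.last m) (WithLp.toLp 2 (fun _ => (1 : ℝ)))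

/-- The box `Q_{d,κ}`. -/
def Qset {m : ℕ} (N : Fin (m + 1) → ℕ) (d : Fin (m + 1) → ℝ) (κ : ℝ) :
    Set (GS N) :=
  {x | (∀ i, i ≠ Fin.last m → ‖x i‖ < d i) ∧
    ‖x (Fin.last m)‖ < κ * d (Fin.last m)}

/-- The cube `(-c,c)^n`. -/
def gCube {m : ℕ} (N : Fin (m + 1) → ℕ) (c : ℝ) : Set (GS N) :=
  {x | ∀ (i : Fin (m + 1)) (j : Fin (N i)), |x i j| < c}

/-- `ℋ^{N-1}(S^{N-1})`. -/
def sphVol (n : ℕ) : ℝ :=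
  (μH[(n : ℝ) - 1] (Metric.sphere (0 : EuclideanSpace ℝ (Fin n)) 1)).toReal

/-- The operator `L_*` acting on functions of `(x,t) ∈ ℝ^n × ℝ`. -/
def LstarOp {m : ℕ} (N : Fin (m + 1) → ℕ) (a s : Fin (m + 1) → ℝ) (ν : ℝ)
    (h : GS N × ℝ → ℝ) (p : GS N × ℝ) : ℝ :=
  (∑ i ∈ Finset.univ.erase (Fin.last m),
      a i * gLap N i (s i) (fun z => h (z, p.2)) p.1)
    - (a (Fin.last m) - ν) * dirD2 (fun z => h (z, p.2)) p.1 (eN N)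
    - ν * dirD2 (fun τ : ℝ => h (p.1, τ)) p.2 1

/-- The barrier `Φ`. -/
def PhiBar {m : ℕ} (N : Fin (m + 1) → ℕ) (s d : Fin (m + 1) → ℝ)
    (ν A₁ A₂ : ℝ) (p : GS N × ℝ) : ℝ :=
  A₁ / ν * (max p.2 0 * max (d (Fin.last m) - p.2) 0 / 2)
    + A₂ * ((∑ i, etaC (N i) (s i) * d i ^ (2 * s i))
        + d (Fin.last m) ^ 2 / 2
        - ∑ i, etaC (N i) (s i) * max (d i ^ 2 - ‖p.1 i‖ ^ 2) 0 ^ s i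
        - max (d (Fin.last m) ^ 2 - p.2 ^ 2) 0 / 2)

/-- `sup` of `|u|` on the open annulus `B_{2ρ} ∖ closure(B_{ρ/2})`. -/
def annSup {n : ℕ} (u : EuclideanSpace ℝ (Fin n) → ℝ) (ρ : ℝ) : ℝ :=
  sSup ((fun x => |u x|) '' {x | ρ / 2 < ‖x‖ ∧ ‖x‖ < 2 * ρ})

/-- `sup` of `|u|` on the open ball `B_r`. -/
def ballSup {n : ℕ} (u : EuclideanSpace ℝ (Fin n) → ℝ) (r : ℝ) : ℝ :=
  sSup ((fun x => |u x|) '' Metric.ball 0 r)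


theorem aux_line {E : Type*} [NormedAddCommGroup E] [NormedSpace ℝ E]
    {u : E → ℝ} {x : E} (v : E) (h : ContDiffAt ℝ 2 u x) :
    ContDiffAt ℝ 2 (fun t : ℝ => u (x + t • v)) 0 := by
  have h1 : ContDiffAt ℝ 2 (fun t : ℝ => x + t • v) 0 := by fun_prop
  have h2 : ContDiffAt ℝ 2 u (x + (0:ℝ) • v) := by simpa using h
  exact ContDiffAt.comp (0:ℝ) h2 h1

theorem aux_dirD2_neg {E : Type*} [NormedAddCommGroup E] [NormedSpace ℝ E]
    (u : E → ℝ) (x v : E) : dirD2 u x (-v) = dirD2 u x v := by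
  unfold dirD2
  have := iteratedDeriv_comp_neg 2 (fun t : ℝ => u (x + t • v)) 0
  simpa using this

theorem aux_dirD2_sub {E : Type*} [NormedAddCommGroup E] [NormedSpace ℝ E]
    (u : E → ℝ) (x w v : E) (h1 : ContDiffAt ℝ 2 u (x + w)) (h2 : ContDiffAt ℝ 2 u (x - w)) :
    dirD2 (fun z => u (z + w) - u (z - w)) x v = dirD2 u (x + w) v - dirD2 u (x - w) v := by
  unfold dirD2
  have e : (fun t : ℝ => u (x + t • v + w) - u (x + t • v - w)) =
      (fun t : ℝ => u (x + w + t • v)) - (fun t : ℝ => u (x - w + t • v)) := by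
    funext t
    simp only [Pi.sub_apply]
    congr 2 <;> abel
  rw [e, iteratedDeriv_sub (aux_line v h1) (aux_line v h2)]

theorem aux_dirD2_t {E : Type*} [NormedAddCommGroup E] [NormedSpace ℝ E]
    (u : E → ℝ) (x e : E) (t : ℝ) (ht : 0 < t)
    (h1 : ContDiffAt ℝ 2 u (x + t • e)) (h2 : ContDiffAt ℝ 2 u (x - t • e)) :
    dirD2 (fun τ : ℝ => u (x + max τ 0 • e) - u (x - max τ 0 • e)) t 1
      = dirD2 u (x + t • e) e - dirD2 u (x - t • e) e := by
  rw [← aux_dirD2_neg u (x - t • e) e]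
  unfold dirD2
  rw [← iteratedDeriv_sub (aux_line e h1) (aux_line (-e) h2)]
  apply Filter.EventuallyEq.iteratedDeriv_eq
  filter_upwards [lt_mem_nhds (show -t < 0 by linarith)] with r hr
  have : max (t + r • (1:ℝ)) 0 = t + r := by
    rw [smul_eq_mul, mul_one]; exact max_eq_left (by linarith)
  simp only [this, Pi.sub_apply]
  congr 2 <;> module

theorem aux_gInt {ι : Type*} [Fintype ι] [DecidableEq ι] (N : ι → ℕ) (i : ι) (si : ℝ)
    (u : GS N → ℝ) (x w : GS N) (h1 : gInt N i si u (x + w)) (h2 : gInt N i si u (x - w)) :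
    gInt N i si (fun z => u (z + w) - u (z - w)) x := by
  rcases h1 with h1 | h1
  · exact Or.inl h1
  rcases h2 with h2 | h2
  · exact Or.inl h2
  refine Or.inr ((h1.sub h2).congr (Filter.Eventually.of_forall fun y => ?_))
  simp only [Pi.sub_apply]
  rw [← sub_div, add_right_comm x w, sub_add_eq_add_sub x w, add_sub_right_comm x w,
    sub_right_comm x w]
  ring

theorem aux_gLap {ι : Type*} [Fintype ι] [DecidableEq ι] (N : ι → ℕ) (i : ι) (si : ℝ)
    (u : GS N → ℝ) (x w : GS N) (h1 : gInt N i si u (x + w)) (h2 : gInt N i si u (x - w))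
    (c1 : ContDiffAt ℝ 2 u (x + w)) (c2 : ContDiffAt ℝ 2 u (x - w)) :
    gLap N i si (fun z => u (z + w) - u (z - w)) x
      = gLap N i si u (x + w) - gLap N i si u (x - w) := by
  unfold gLap
  split_ifs with hs
  · simp only [aux_dirD2_sub u x w _ c1 c2, Finset.sum_sub_distrib]
    ring
  · have h1 := h1.resolve_left hs
    have h2 := h2.resolve_left hs
    rw [← mul_sub, ← integral_sub h1 h2]
    congr 1
    apply integral_congr_ae
    refine Filter.Eventually.of_forall fun y => ?_
    simp only []
    rw [← sub_div, add_right_comm x w, sub_add_eq_add_sub x w, add_sub_right_comm x w,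
      sub_right_comm x w]
    ring

theorem aux_mem {m : ℕ} (N : Fin (m + 1) → ℕ) (hN : N (Fin.last m) = 1)
    (d : Fin (m + 1) → ℝ) (x : GS N) (hx : x ∈ Qset N d 1) (r : ℝ)
    (hr : |r| < d (Fin.last m)) : x + r • eN N ∈ Qset N d 2 := by
  have hone : ‖(WithLp.toLp 2 (fun _ => (1 : ℝ)) : EuclideanSpace ℝ (Fin (N (Fin.last m))))‖ = 1 := by
    rw [EuclideanSpace.norm_eq]; simp [hN]
  refine ⟨fun i hi => ?_, ?_⟩
  · have : (x + r • eN N) i = x i := by simp [eN, grpIncl, hi]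
    rw [this]; exact hx.1 i hi
  · have : (x + r • eN N) (Fin.last m) = x (Fin.last m) + r • (WithLp.toLp 2 (fun _ => (1 : ℝ))) := by
      simp [eN, grpIncl]
    rw [this]
    have h := norm_add_le (x (Fin.last m))
      (r • (WithLp.toLp 2 (fun _ => (1 : ℝ)) : EuclideanSpace ℝ (Fin (N (Fin.last m)))))
    rw [norm_smul, hone, Real.norm_eq_abs] at h
    have := hx.2
    linarith

theorem aux_last {m : ℕ} (N : Fin (m + 1) → ℕ) (hN : N (Fin.last m) = 1)
    (u : GS N → ℝ) (x : GS N) :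
    gLap N (Fin.last m) 1 u x = - dirD2 u x (eN N) := by
  unfold gLap
  rw [if_pos rfl]
  have key : ∀ j : Fin (N (Fin.last m)), grpIncl N (Fin.last m) (EuclideanSpace.single j 1) = eN N := by
    intro j
    unfold eN
    congr 1
    ext k
    have : k = j := by
      apply Fin.ext
      have := k.2
      have := j.2
      omega
    simp [this]
  simp [key, hN]

theorem stmt9 {m : ℕ} (N : Fin (m + 1) → ℕ) (hN : N (Fin.last m) = 1)
    (s : Fin (m + 1) → ℝ) (hs : ∀ i, s i ∈ Set.Ioc (0 : ℝ) 1)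
    (hsl : s (Fin.last m) = 1)
    (a : Fin (m + 1) → ℝ) (ha : ∀ i, 0 ≤ a i) (hal : 0 < a (Fin.last m))
    (d : Fin (m + 1) → ℝ) (hd : ∀ i, 0 < d i)
    (ν : ℝ) (hν : ν ∈ Set.Ioo 0 (a (Fin.last m)))
    (u f : GS N → ℝ) (hsol : IsSol N a s u f (Qset N d 2))
    (Mu : ℝ) (hMu : ∀ x, |u x| ≤ Mu) :
    ∀ x ∈ Qset N d 1, ∀ t ∈ Set.Ioo (0 : ℝ) (d (Fin.last m)),
      (∀ i ∈ Finset.univ.erase (Fin.last m),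
        gInt N i (s i)
          (fun z => u (z + max t 0 • eN N) - u (z - max t 0 • eN N)) x) ∧
      ContDiffAt ℝ 2 (fun τ : ℝ => u (x + max τ 0 • eN N) - u (x - max τ 0 • eN N)) t ∧
      ContDiffAt ℝ 2 (fun ξ : GS N => u (ξ + max t 0 • eN N) - u (ξ - max t 0 • eN N)) x ∧
      LstarOp N a s ν
          (fun p => u (p.1 + max p.2 0 • eN N) - u (p.1 - max p.2 0 • eN N)) (x, t)
        = f (x + max t 0 • eN N) - f (x - max t 0 • eN N) := by
  intro x hx t ht
  obtain ⟨ht0, htd⟩ := ht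
  have hmax : max t 0 = t := max_eq_left ht0.le
  have hp : x + t • eN N ∈ Qset N d 2 := aux_mem N hN d x hx t (by rwa [abs_of_pos ht0])
  have hq : x - t • eN N ∈ Qset N d 2 := by
    have := aux_mem N hN d x hx (-t) (by rwa [abs_neg, abs_of_pos ht0])
    rwa [neg_smul, ← sub_eq_add_neg] at this
  obtain ⟨cp, ip, lp⟩ := hsol.2 _ hp
  obtain ⟨cq, iq, lq⟩ := hsol.2 _ hq
  refine ⟨fun i _ => ?_, ?_, ?_, ?_⟩
  · rw [hmax]; exact aux_gInt N i _ u x _ (ip i) (iq i)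
  · have h : ContDiffAt ℝ 2 (fun τ : ℝ => u (x + τ • eN N) - u (x - τ • eN N)) t := by
      have g1 : ContDiffAt ℝ 2 (fun τ : ℝ => x + τ • eN N) t := by fun_prop
      have g2 : ContDiffAt ℝ 2 (fun τ : ℝ => x - τ • eN N) t := by fun_prop
      exact (ContDiffAt.comp t cp g1).sub (ContDiffAt.comp t cq g2)
    refine h.congr_of_eventuallyEq ?_
    filter_upwards [lt_mem_nhds ht0] with r hr
    rw [max_eq_left hr.le]
  · rw [hmax]
    have g1 : ContDiffAt ℝ 2 (fun ξ : GS N => ξ + t • eN N) x := by fun_prop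
    have g2 : ContDiffAt ℝ 2 (fun ξ : GS N => ξ - t • eN N) x := by fun_prop
    exact (ContDiffAt.comp x cp g1).sub (ContDiffAt.comp x cq g2)
  · unfold LstarOp
    simp only [hmax]
    rw [aux_dirD2_t u x (eN N) t ht0 cp cq, aux_dirD2_sub u x _ _ cp cq, ← lp, ← lq]
    unfold Lop
    rw [← Finset.sum_erase_add _ _ (Finset.mem_univ (Fin.last m)),
      ← Finset.sum_erase_add _ _ (Finset.mem_univ (Fin.last m)), hsl,
      aux_last N hN, aux_last N hN]
    have : ∑ i ∈ Finset.univ.erase (Fin.last m),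
        a i * gLap N i (s i) (fun z => u (z + t • eN N) - u (z - t • eN N)) x
        = ∑ i ∈ Finset.univ.erase (Fin.last m), a i * gLap N i (s i) u (x + t • eN N)
          - ∑ i ∈ Finset.univ.erase (Fin.last m), a i * gLap N i (s i) u (x - t • eN N) := by
      rw [← Finset.sum_sub_distrib]
      refine Finset.sum_congr rfl fun i _ => ?_
      rw [aux_gLap N i _ u x _ (ip i) (iq i) cp cq, mul_sub]
    rw [this]
    ring

end
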